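/- Let f : ℝ → ℝ be arbitrary, and define ĥ₀(x, y) = f(2x) and ĥ₁(x, y) = f(2x+1). If F : ℝ → ℝ solves the safe-integration equation for (f(0), ĥ₀, ĥ₁), then F(n) = f(n) for every n ∈ ℕ; thus F agrees with f on the natural numbers (and, being a solution of the safe-integration equation, F is peaceful). -/

import Mathlib

noncomputable def parity (x : ℝ) : ℝ := max 0 (Real.pi / 2 * Real.sin (Real.pi * x))

noncomputable def pfun (x : ℝ) : ℝ := ∫ t in (0:ℝ)..(x - 1), parity t

noncomputable def pfun' (x : ℝ) : ℝ := pfun (x - 1) + 1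

def SolvesSafeIntegration (g0 : ℝ) (h0 h1 : ℝ → ℝ → ℝ) (f : ℝ → ℝ) : Prop :=
  f 0 = g0 ∧ ∀ x : ℝ, HasDerivAt f
    (parity x * (h1 (pfun x) (f (pfun x)) - f (2 * pfun x)) +
     parity (x - 1) * (h0 (pfun' x) (f (pfun' x)) - f (2 * pfun' x - 1))) x

theorem continuous_parity : Continuous parity := by
  unfold parity
  fun_prop

theorem parity_nonneg (x : ℝ) : 0 ≤ parity x := le_max_left _ _

theorem parity_add_two (x : ℝ) : parity (x + 2) = parity x := by
  unfold parity
  rw [show Real.pi * (x + 2) = Real.pi * x + 2 * Real.pi by ring, Real.sin_add_two_pi]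

theorem parity_of_mem_Icc_zero_one {x : ℝ} (hx : x ∈ Set.Icc (0 : ℝ) 1) :
    parity x = Real.pi / 2 * Real.sin (Real.pi * x) := by
  have hpi := Real.pi_pos
  refine max_eq_right (mul_nonneg (by positivity) (Real.sin_nonneg_of_nonneg_of_le_pi ?_ ?_))
  · exact mul_nonneg hpi.le hx.1
  · nlinarith [hx.2]

theorem parity_of_mem_Icc_neg_one_zero {x : ℝ} (hx : x ∈ Set.Icc (-1 : ℝ) 0) :
    parity x = 0 := by
  have hpi := Real.pi_pos
  refine max_eq_left (mul_nonpos_of_nonneg_of_nonpos (by positivity)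
    (Real.sin_nonpos_of_nonpos_of_neg_pi_le ?_ ?_))
  · exact mul_nonpos_of_nonneg_of_nonpos hpi.le hx.2
  · nlinarith [hx.1]

theorem parity_eq_zero (k : ℕ) {x : ℝ} (hx : x ∈ Set.Icc (2 * (k : ℝ) - 1) (2 * k)) :
    parity x = 0 := by
  induction k generalizing x with
  | zero => exact parity_of_mem_Icc_neg_one_zero (by simpa using hx)
  | succ k ih =>
    rw [← sub_add_cancel x 2, parity_add_two]
    push_cast at hx
    exact ih ⟨by linarith [hx.1], by linarith [hx.2]⟩

theorem hasDerivAt_pfun (x : ℝ) : HasDerivAt pfun (parity (x - 1)) x := by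
  have h := intervalIntegral.integral_hasDerivAt_right
    (continuous_parity.intervalIntegrable 0 (x - 1))
    continuous_parity.stronglyMeasurable.stronglyMeasurableAtFilter
    continuous_parity.continuousAt
  exact h.comp_sub_const x 1

theorem monotone_pfun : Monotone pfun :=
  monotone_of_hasDerivAt_nonneg hasDerivAt_pfun fun x => parity_nonneg (x - 1)

theorem integral_parity_zero_one : ∫ t in (0 : ℝ)..1, parity t = 1 := by
  have hpi := Real.pi_ne_zero
  have h : ∫ t in (0 : ℝ)..1, parity t =
      ∫ t in (0 : ℝ)..1, Real.pi / 2 * Real.sin (Real.pi * t) :=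
    intervalIntegral.integral_congr fun t ht =>
      parity_of_mem_Icc_zero_one (by rwa [Set.uIcc_of_le zero_le_one] at ht)
  rw [h, intervalIntegral.integral_const_mul,
    intervalIntegral.integral_comp_mul_left (fun t => Real.sin t) hpi, integral_sin]
  simp
  field_simp
  norm_num

theorem integral_parity_neg_one_zero : ∫ t in (-1 : ℝ)..0, parity t = 0 := by
  have h : ∫ t in (-1 : ℝ)..0, parity t = ∫ t in (-1 : ℝ)..0, (0 : ℝ) :=
    intervalIntegral.integral_congr fun t ht =>
      parity_of_mem_Icc_neg_one_zero (by rwa [Set.uIcc_of_le (by norm_num)] at ht)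
  rw [h, intervalIntegral.integral_zero]

theorem pfun_zero : pfun 0 = 0 := by
  rw [pfun, intervalIntegral.integral_symm, zero_sub, integral_parity_neg_one_zero, neg_zero]

theorem pfun_one : pfun 1 = 0 := by simp [pfun]

theorem pfun_two : pfun 2 = 1 := by
  rw [pfun, show (2 : ℝ) - 1 = 1 by norm_num, integral_parity_zero_one]

theorem pfun_add_two (x : ℝ) : pfun (x + 2) = pfun x + 1 := by
  have hd (y : ℝ) : HasDerivAt (fun z => pfun (z + 2) - pfun z) 0 y := by
    have h := ((hasDerivAt_pfun (y + 2)).comp_add_const y 2).sub (hasDerivAt_pfun y)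
    rwa [show y + 2 - 1 = y - 1 + 2 by ring, parity_add_two, sub_self] at h
  have h := is_const_of_deriv_eq_zero (fun y => (hd y).differentiableAt)
    (fun y => (hd y).deriv) x 0
  simp only [zero_add, pfun_two, pfun_zero] at h
  linarith

theorem pfun_two_mul (k : ℕ) : pfun (2 * k) = k := by
  induction k with
  | zero => simpa using pfun_zero
  | succ k ih =>
    rw [Nat.cast_succ, show 2 * ((k : ℝ) + 1) = 2 * k + 2 by ring, pfun_add_two, ih]

theorem pfun_two_mul_add_one (k : ℕ) : pfun (2 * k + 1) = k := by
  induction k with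
  | zero => simpa using pfun_one
  | succ k ih =>
    rw [Nat.cast_succ, show 2 * ((k : ℝ) + 1) + 1 = 2 * k + 1 + 2 by ring, pfun_add_two, ih]

theorem pfun_eq (k : ℕ) {x : ℝ} (hx : x ∈ Set.Icc (2 * (k : ℝ)) (2 * k + 1)) :
    pfun x = k :=
  le_antisymm ((monotone_pfun hx.2).trans_eq (pfun_two_mul_add_one k))
    ((pfun_two_mul k).symm.trans_le (monotone_pfun hx.1))

theorem eq_add_mul_pfun {F : ℝ → ℝ} {c d : ℝ} (k : ℕ)
    (hF : ∀ x ∈ Set.Icc (2 * k + d) (2 * k + d + 1), HasDerivAt F (parity (x - d) * c) x)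
    {x : ℝ} (hx : x ∈ Set.Icc (2 * k + d) (2 * k + d + 1)) :
    F x = F (2 * k + d) + c * (pfun (x - d + 1) - k) := by
  have hd : ∀ y ∈ Set.Icc (2 * k + d) (2 * k + d + 1),
      HasDerivAt (fun z => F z - c * pfun (z - (d - 1))) 0 y := fun y hy => by
    have h := (hF y hy).sub
      (((hasDerivAt_pfun (y - (d - 1))).comp_sub_const y (d - 1)).const_mul c)
    rwa [show y - (d - 1) - 1 = y - d by ring, mul_comm, sub_self] at h
  have h := constant_of_has_deriv_right_zero
    (fun y hy => (hd y hy).continuousAt.continuousWithinAt)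
    (fun y hy => (hd y (Set.Ico_subset_Icc_self hy)).hasDerivWithinAt) x hx
  rw [show 2 * k + d - (d - 1) = 2 * k + 1 by ring, pfun_two_mul_add_one,
    show x - (d - 1) = x - d + 1 by ring] at h
  linarith

theorem eq_and_mem_uIcc_of_hasDerivAt {F : ℝ → ℝ} {c d : ℝ} (k : ℕ)
    (hF : ∀ x ∈ Set.Icc (2 * k + d) (2 * k + d + 1),
      HasDerivAt F (parity (x - d) * (c - F (2 * k + d))) x) :
    F (2 * k + d + 1) = c ∧ ∀ x ∈ Set.Icc (2 * k + d) (2 * k + d + 1),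
      F x ∈ Set.uIcc (F (2 * k + d)) c := by
  have key {x : ℝ} (hx : x ∈ Set.Icc (2 * k + d) (2 * k + d + 1)) := eq_add_mul_pfun k hF hx
  have hp : pfun (2 * k + 2) = k + 1 := by rw [pfun_add_two, pfun_two_mul]
  refine ⟨?_, fun x hx => ?_⟩
  · rw [key ⟨by linarith, le_rfl⟩, show 2 * k + d + 1 - d + 1 = 2 * k + 2 by ring, hp]
    ring
  · have h0 : (k : ℝ) ≤ pfun (x - d + 1) :=
      (pfun_two_mul_add_one k).symm.trans_le (monotone_pfun (by linarith [hx.1]))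
    have h1 : pfun (x - d + 1) ≤ k + 1 := (monotone_pfun (by linarith [hx.2])).trans_eq hp
    rw [← segment_eq_uIcc, segment_eq_image']
    exact ⟨pfun (x - d + 1) - k, ⟨by linarith, by linarith⟩,
      by simp only [key hx, smul_eq_mul, mul_comm]⟩

theorem SolvesSafeIntegration.succ_and_mem_uIcc {f F : ℝ → ℝ}
    (hF : SolvesSafeIntegration (f 0) (fun x _ => f (2 * x)) (fun x _ => f (2 * x + 1)) F)
    (n : ℕ) :
    F (n + 1) = f (n + 1) ∧
      ∀ x ∈ Set.Icc (n : ℝ) (n + 1), F x ∈ Set.uIcc (F n) (f (n + 1)) := by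
  obtain ⟨k, rfl | rfl⟩ := n.even_or_odd'
  · have h := eq_and_mem_uIcc_of_hasDerivAt (F := F) (c := f (2 * k + 1)) (d := 0) k fun x hx => by
      rw [add_zero] at hx ⊢
      have h := hF.2 x
      rw [pfun_eq k hx, parity_eq_zero (x := x - 1) k ⟨by linarith [hx.1], by linarith [hx.2]⟩] at h
      simpa using h
    simpa using h
  · have h := eq_and_mem_uIcc_of_hasDerivAt (F := F) (c := f (2 * k + 1 + 1)) (d := 1) k fun x hx => by
      have h := hF.2 x
      rw [pfun', pfun_eq (x := x - 1) k ⟨by linarith [hx.1], by linarith [hx.2]⟩,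
        parity_eq_zero (k + 1) (x := x)
          (by push_cast; exact ⟨by linarith [hx.1], by linarith [hx.2]⟩),
        zero_mul, zero_add, show 2 * ((k : ℝ) + 1) - 1 = 2 * k + 1 by ring] at h
      beta_reduce at h
      rwa [show 2 * ((k : ℝ) + 1) = 2 * k + 1 + 1 by ring] at h
    simpa using h

theorem peaceful_extension_agrees (f F : ℝ → ℝ)
    (hF : SolvesSafeIntegration (f 0) (fun x _ => f (2*x)) (fun x _ => f (2*x + 1)) F) :
    (∀ n : ℕ, F n = f n) ∧
    (∀ x : ℝ, 0 ≤ x → F x ∈ Set.uIcc (F (⌊x⌋ : ℤ)) (F (⌈x⌉ : ℤ))) := by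
  refine ⟨fun n => ?_, fun x hx => ?_⟩
  · cases n with
    | zero => simpa using hF.1
    | succ n => simpa using (hF.succ_and_mem_uIcc n).1
  · rw [← natCast_floor_eq_intCast_floor hx, ← natCast_ceil_eq_intCast_ceil hx]
    obtain ⟨hsucc, hmem⟩ := hF.succ_and_mem_uIcc ⌊x⌋₊
    rcases (Nat.ceil_le_floor_add_one x).lt_or_eq with h | h
    · have hfc : (⌊x⌋₊ : ℝ) = ⌈x⌉₊ := by
        exact_mod_cast (Nat.floor_le_ceil x).antisymm (Nat.lt_succ_iff.mp h)
      have hxc : x = ⌈x⌉₊ := (Nat.le_ceil x).antisymm (hfc ▸ Nat.floor_le hx)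
      rw [← hxc]
      exact Set.right_mem_uIcc
    · rw [h, Nat.cast_succ, hsucc]
      exact hmem x ⟨Nat.floor_le hx, (Nat.lt_floor_add_one x).le⟩
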